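/- Fix d ∈ ℕ and R > 0. Let f : ℝ^d → ℂ be continuous and Lebesgue integrable, and suppose there exists a function F : ℂ^d → ℂ that is holomorphic (complex Fréchet differentiable) on the open tube {λ ∈ ℂ^d : ‖Re λ‖ < R}, satisfies F(iξ) = ∫_{ℝ^d} f(v)·exp(i·⟨ξ, v⟩) dv for all ξ ∈ ℝ^d, and such that for every r with 0 < r < R and every N ∈ ℕ, sup { |F(λ)|·(1 + ‖λ‖)^N : λ ∈ ℂ^d, ‖Re λ‖ ≤ r } < ∞. Then f is smooth, and for every r with 0 < r < R and every k ∈ ℕ there exists C > 0 such that ‖iteratedFDeriv ℝ k f v‖ ≤ C · exp(−r·‖v‖) for all v ∈ ℝ^d. -/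

import Mathlib

open MeasureTheory

/-- The componentwise real part of a vector in `ℂ^d`, as a vector of `ℝ^d`. -/
noncomputable def reVec (d : ℕ) (lam : EuclideanSpace ℂ (Fin d)) :
    EuclideanSpace ℝ (Fin d) :=
  (EuclideanSpace.equiv (Fin d) ℝ).symm fun i => (lam i).re

namespace ExpDecay
open Filter Topology Metric Complex

/-- Complexification of a real vector. -/
noncomputable def cV {d : ℕ} (v : EuclideanSpace ℝ (Fin d)) : EuclideanSpace ℂ (Fin d) :=
  WithLp.toLp 2 fun i => (v i : ℂ)

variable {d : ℕ}

@[simp] lemma cV_apply (v : EuclideanSpace ℝ (Fin d)) (i : Fin d) : cV v i = (v i : ℂ) := rfl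

@[simp] lemma reVec_apply (l : EuclideanSpace ℂ (Fin d)) (i : Fin d) :
    reVec d l i = (l i).re := rfl

lemma cV_add (v w : EuclideanSpace ℝ (Fin d)) : cV (v + w) = cV v + cV w := by
  ext i; simp

lemma cV_smul (t : ℝ) (v : EuclideanSpace ℝ (Fin d)) : cV (t • v) = (t : ℂ) • cV v := by
  ext i; simp

@[simp] lemma norm_cV (v : EuclideanSpace ℝ (Fin d)) : ‖cV v‖ = ‖v‖ := by
  simp [EuclideanSpace.norm_eq]

@[fun_prop] lemma continuous_cV : Continuous (cV : EuclideanSpace ℝ (Fin d) → _) := by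
  unfold cV
  fun_prop

@[fun_prop] lemma continuous_reVec : Continuous (reVec d) := by
  unfold reVec
  fun_prop

/-- The affine parametrization of the tube. -/
noncomputable def pt (η : EuclideanSpace ℝ (Fin d)) (z : ℂ) (w : EuclideanSpace ℝ (Fin d)) :
    EuclideanSpace ℂ (Fin d) := z • cV η + (2 * Real.pi * I : ℂ) • cV w

lemma reVec_pt (η : EuclideanSpace ℝ (Fin d)) (z : ℂ) (w : EuclideanSpace ℝ (Fin d)) :
    reVec d (pt η z w) = z.re • η := by
  ext i; simp [pt]

lemma norm_reVec_pt (η : EuclideanSpace ℝ (Fin d)) (z : ℂ) (w : EuclideanSpace ℝ (Fin d)) :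
    ‖reVec d (pt η z w)‖ = |z.re| * ‖η‖ := by
  rw [reVec_pt, norm_smul, Real.norm_eq_abs]

lemma pt_shift (η : EuclideanSpace ℝ (Fin d)) (z : ℂ) (y : ℝ) (w : EuclideanSpace ℝ (Fin d)) :
    pt η (z + y * I) w = pt η z (w + (y / (2 * Real.pi)) • η) := by
  have : (Real.pi : ℂ) ≠ 0 := by exact_mod_cast Real.pi_ne_zero
  ext i
  simp [pt]
  field_simp
  ring

lemma one_add_norm_le (η : EuclideanSpace ℝ (Fin d)) (z : ℂ) (w : EuclideanSpace ℝ (Fin d))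
    {A : ℝ} (hA : ‖z‖ * ‖η‖ ≤ A) : 1 + ‖w‖ ≤ (1 + A) * (1 + ‖pt η z w‖) := by
  have h1 : ‖(2 * Real.pi * I : ℂ) • cV w‖ ≤ ‖pt η z w‖ + ‖z • cV η‖ := by
    have : (2 * Real.pi * I : ℂ) • cV w = pt η z w - z • cV η := by simp [pt]
    rw [this]; exact norm_sub_le _ _
  have h2 : ‖(2 * Real.pi * I : ℂ) • cV w‖ = 2 * Real.pi * ‖w‖ := by
    simp [norm_smul, abs_of_pos Real.pi_pos]
  have h3 : ‖z • cV η‖ ≤ A := by simpa [norm_smul] using hA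
  have h4 : ‖w‖ ≤ 2 * Real.pi * ‖w‖ := by
    nlinarith [norm_nonneg w, Real.pi_gt_three]
  have hA0 : 0 ≤ A := (by positivity : 0 ≤ ‖z‖ * ‖η‖).trans hA
  nlinarith [norm_nonneg (pt η z w), mul_nonneg hA0 (norm_nonneg (pt η z w))]

lemma key_bound (η : EuclideanSpace ℝ (Fin d)) (z : ℂ) (w : EuclideanSpace ℝ (Fin d))
    {A : ℝ} (hA : ‖z‖ * ‖η‖ ≤ A) {N : ℕ} {C x : ℝ} (hx : 0 ≤ x)
    (h : x * (1 + ‖pt η z w‖) ^ N ≤ C) :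
    x ≤ C * (1 + A) ^ N * ((1 + ‖w‖) ^ N)⁻¹ := by
  have hA0 : 0 ≤ A := (by positivity : 0 ≤ ‖z‖ * ‖η‖).trans hA
  rw [← div_eq_mul_inv, le_div_iff₀ (by positivity)]
  calc x * (1 + ‖w‖) ^ N ≤ x * ((1 + A) * (1 + ‖pt η z w‖)) ^ N := by
        gcongr; exact one_add_norm_le η z w hA
    _ = (x * (1 + ‖pt η z w‖) ^ N) * (1 + A) ^ N := by rw [mul_pow]; ring
    _ ≤ C * (1 + A) ^ N := by gcongr

lemma integrable_bound (d : ℕ) :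
    Integrable (fun w : EuclideanSpace ℝ (Fin d) => ((1 + ‖w‖) ^ (d + 1))⁻¹) := by
  have := integrable_one_add_norm (E := EuclideanSpace ℝ (Fin d)) (μ := volume)
    (r := ((d + 1 : ℕ) : ℝ)) (by simp)
  refine this.congr (Eventually.of_forall fun w => ?_)
  simp only
  rw [Real.rpow_neg (by positivity), Real.rpow_natCast]

lemma isOpen_tube (R : ℝ) : IsOpen {l : EuclideanSpace ℂ (Fin d) | ‖reVec d l‖ < R} :=
  isOpen_lt (by fun_prop) continuous_const

lemma cont_slice {R : ℝ} {H : EuclideanSpace ℂ (Fin d) → ℂ}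
    (hH : DifferentiableOn ℂ H {l | ‖reVec d l‖ < R})
    (η : EuclideanSpace ℝ (Fin d)) (z : ℂ) (hz : |z.re| * ‖η‖ < R) :
    Continuous fun w => H (pt η z w) := by
  refine hH.continuousOn.comp_continuous (by unfold pt; fun_prop) fun w => ?_
  simpa [norm_reVec_pt] using hz

lemma shift {R : ℝ} {H : EuclideanSpace ℂ (Fin d) → ℂ}
    (hH : DifferentiableOn ℂ H {l | ‖reVec d l‖ < R})
    (hb : ∀ r : ℝ, 0 < r → r < R → ∃ C : ℝ, ∀ l, ‖reVec d l‖ ≤ r →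
      ‖H l‖ * (1 + ‖l‖) ^ (d + 1) ≤ C)
    (η : EuclideanSpace ℝ (Fin d)) (hη : ‖η‖ < R) :
    ∫ w, H (pt η 0 w) = ∫ w, H (pt η 1 w) := by
  obtain ⟨ρ, hρ1, hρ2⟩ := exists_between hη
  have hρ0 : 0 < ρ := (norm_nonneg _).trans_lt hρ1
  obtain ⟨C, hC⟩ := hb ρ hρ0 hρ2
  set S : Set ℂ := {z | |z.re| * ‖η‖ < ρ} with hS
  have hSo : IsOpen S := isOpen_lt (by fun_prop) continuous_const
  have hSc : Convex ℝ S := by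
    intro x hx y hy a b ha hb hab
    simp only [hS, Set.mem_ofPred_eq] at hx hy ⊢
    have h1 : |(a • x + b • y).re| ≤ a * |x.re| + b * |y.re| := by
      simp only [add_re, real_smul, mul_re, ofReal_re, ofReal_im, zero_mul, sub_zero]
      refine (abs_add_le _ _).trans ?_
      rw [abs_mul, abs_mul, abs_of_nonneg ha, abs_of_nonneg hb]
    have h2 : a * (|x.re| * ‖η‖) + b * (|y.re| * ‖η‖) < ρ := by
      have := (convex_Iio (𝕜 := ℝ) ρ) hx hy ha hb hab
      simpa using this
    nlinarith [norm_nonneg η, mul_le_mul_of_nonneg_right h1 (norm_nonneg η)]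
  have hcont : ∀ z ∈ S, Continuous fun w => H (pt η z w) := fun z hz =>
    cont_slice hH η z (lt_trans hz hρ2)
  have hdiff : ∀ w, ∀ z ∈ S, DifferentiableAt ℂ (fun z => H (pt η z w)) z := by
    intro w z hz
    have hm : pt η z w ∈ {l : EuclideanSpace ℂ (Fin d) | ‖reVec d l‖ < R} := by
      simpa [norm_reVec_pt] using lt_trans hz hρ2
    have h1 := (hH _ hm).differentiableAt ((isOpen_tube R).mem_nhds hm)
    refine DifferentiableAt.comp (g := H) z h1 ?_
    unfold pt
    fun_prop
  have hbd : ∀ A : ℝ, ∀ z ∈ S, ‖z‖ * ‖η‖ ≤ A → ∀ w,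
      ‖H (pt η z w)‖ ≤ C * (1 + A) ^ (d + 1) * ((1 + ‖w‖) ^ (d + 1))⁻¹ := by
    intro A z hz hA w
    refine key_bound η z w hA (norm_nonneg _) (hC _ ?_)
    rw [norm_reVec_pt]; exact le_of_lt hz
  set g : ℂ → ℂ := fun z => ∫ w, H (pt η z w) with hg
  have hgd : ∀ z ∈ S, DifferentiableAt ℂ g z := by
    intro z0 hz0
    obtain ⟨ε', hε', hball⟩ := Metric.isOpen_iff.1 hSo z0 hz0
    set ε := ε' / 3 with hε
    have hε0 : 0 < ε := by positivity
    have hin : ∀ z, dist z z0 ≤ 2 * ε → z ∈ S := fun z hz =>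
      hball (by rw [mem_ball]; linarith)
    set A := (‖z0‖ + 2 * ε) * ‖η‖ with hA
    have hAz : ∀ z, dist z z0 ≤ 2 * ε → ‖z‖ * ‖η‖ ≤ A := by
      intro z hz
      have : ‖z‖ ≤ ‖z0‖ + 2 * ε := by
        rw [dist_eq_norm] at hz
        have := norm_le_norm_add_norm_sub' z z0
        linarith
      rw [hA]; gcongr
    have hmeas : AEStronglyMeasurable (fun w => deriv (fun z => H (pt η z w)) z0) volume := by
      set u : ℕ → ℂ := fun n => z0 + ((ε * (1 / ((n : ℝ) + 1)) : ℝ) : ℂ) with hu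
      have hu1 : Tendsto u atTop (𝓝[≠] z0) := by
        refine tendsto_nhdsWithin_iff.2 ⟨?_, Eventually.of_forall fun n => ?_⟩
        · have h0 : Tendsto (fun n : ℕ => ε * (1 / ((n : ℝ) + 1))) atTop (𝓝 0) := by
            simpa using tendsto_one_div_add_atTop_nhds_zero_nat.const_mul ε
          have h1 := (Complex.continuous_ofReal.tendsto 0).comp h0
          simpa [hu, Function.comp_def] using h1.const_add z0
        · simp only [hu, Set.mem_compl_iff, Set.mem_singleton_iff, add_eq_left, ofReal_eq_zero]
          positivity
      have hu2 : ∀ n, u n ∈ S := by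
        intro n
        apply hin
        rw [dist_eq_norm, hu]
        simp only [add_sub_cancel_left, norm_real, Real.norm_eq_abs]
        rw [abs_of_nonneg (by positivity)]
        have : 1 / ((n : ℝ) + 1) ≤ 1 := by
          rw [div_le_one (by positivity)]; linarith [Nat.cast_nonneg (α := ℝ) n]
        nlinarith
      refine aestronglyMeasurable_of_tendsto_ae (u := atTop)
        (f := fun n w => slope (fun z => H (pt η z w)) z0 (u n)) ?_
        (Eventually.of_forall fun w => ?_)
      · intro n
        simp only [slope_def_field]
        exact (((hcont _ (hu2 n)).sub (hcont _ hz0)).div_const _).aestronglyMeasurable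
      · exact ((hdiff w z0 hz0).hasDerivAt.tendsto_slope).comp hu1
    have := hasDerivAt_integral_of_dominated_loc_of_deriv_le (μ := volume)
      (F := fun z w => H (pt η z w)) (F' := fun z w => deriv (fun z => H (pt η z w)) z)
      (x₀ := z0) (s := ball z0 ε)
      (bound := fun w => C * (1 + A) ^ (d + 1) * ((1 + ‖w‖) ^ (d + 1))⁻¹ / ε)
      (ball_mem_nhds _ hε0)
      ((hSo.eventually_mem hz0).mono fun z hz => (hcont z hz).aestronglyMeasurable)
      ?_ hmeas ?_ (((integrable_bound d).const_mul _).div_const _) ?_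
    · exact this.2.differentiableAt
    · refine ((integrable_bound d).const_mul (C * (1 + A) ^ (d + 1))).mono'
        (hcont z0 hz0).aestronglyMeasurable (Eventually.of_forall fun w => ?_)
      exact hbd A z0 hz0 (hAz z0 (by simp [hε0.le])) w
    · refine Eventually.of_forall fun w z hz => ?_
      have hz' : dist z z0 < ε := hz
      have hcl : ∀ y, dist y z ≤ ε → dist y z0 ≤ 2 * ε := by
        intro y hy
        linarith [dist_triangle y z z0]
      refine Complex.norm_deriv_le_of_forall_mem_sphere_norm_le hε0 ?_ ?_
      · refine DifferentiableOn.diffContOnCl (𝕜 := ℂ) fun y hy => ?_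
        refine (hdiff w y (hin y (hcl y ?_))).differentiableWithinAt
        exact mem_closedBall.1 (closure_ball_subset_closedBall hy)
      · intro y hy
        have hy' := hcl y (le_of_eq (mem_sphere.1 hy))
        exact hbd A y (hin y hy') (hAz y hy') w
    · refine Eventually.of_forall fun w z hz => ?_
      have hz' : dist z z0 < ε := hz
      exact (hdiff w z (hin z (by linarith))).hasDerivAt
  have hgp : ∀ z, ∀ y : ℝ, g (z + y * I) = g z := by
    intro z y
    simp only [hg, pt_shift]
    exact integral_add_right_eq_self (fun w => H (pt η z w)) _
  have hg0 : S.EqOn (deriv g) 0 := by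
    intro z hz
    have h1 := (hgd z hz).hasDerivAt
    have h2 : HasDerivAt (fun y : ℝ => z + y * I) I 0 := by
      simpa using ((Complex.ofRealCLM.hasDerivAt (x := (0 : ℝ))).mul_const I).const_add z
    have h1' : HasDerivAt g (deriv g z) (z + ((0 : ℝ) : ℂ) * I) := by simpa using h1
    have h3 := HasDerivAt.comp (𝕜 := ℝ) (𝕜' := ℂ) (0 : ℝ) h1' h2
    have h4 : (g ∘ fun y : ℝ => z + y * I) = fun _ => g z := by
      ext y; exact hgp z y
    rw [h4] at h3
    have h5 := h3.unique (hasDerivAt_const (0 : ℝ) (g z))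
    simpa using h5
  have h0 : (0 : ℂ) ∈ S := by simpa [hS] using hρ0
  have h1 : (1 : ℂ) ∈ S := by simpa [hS] using hρ1
  exact hSo.is_const_of_deriv_eq_zero hSc.isPreconnected
    (fun z hz => (hgd z hz).differentiableWithinAt) hg0 h0 h1

/-- The complex bilinear pairing with a real vector. -/
noncomputable def pair (m : EuclideanSpace ℝ (Fin d)) : EuclideanSpace ℂ (Fin d) →L[ℂ] ℂ :=
  innerSL ℂ (cV m)

lemma pair_apply (m : EuclideanSpace ℝ (Fin d)) (l : EuclideanSpace ℂ (Fin d)) :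
    pair m l = ∑ i, l i * (m i : ℂ) := by
  simp [pair, PiLp.inner_apply]

lemma norm_pair_le (m : EuclideanSpace ℝ (Fin d)) (l : EuclideanSpace ℂ (Fin d)) :
    ‖pair m l‖ ≤ ‖m‖ * ‖l‖ := by
  simpa [pair] using norm_inner_le_norm (𝕜 := ℂ) (cV m) l

lemma pair_re (m : EuclideanSpace ℝ (Fin d)) (l : EuclideanSpace ℂ (Fin d)) :
    (pair m l).re = inner ℝ (reVec d l) m := by
  simp [pair_apply, PiLp.inner_apply, mul_comm]

lemma pair_cV (m w : EuclideanSpace ℝ (Fin d)) :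
    pair m (cV w) = ((inner ℝ w m : ℝ) : ℂ) := by
  simp [pair_apply, PiLp.inner_apply, mul_comm]

lemma pow_absorb {x L C : ℝ} {k N : ℕ} (hx : 0 ≤ x) (hL : 0 ≤ L)
    (h : x * (1 + L) ^ (k + N) ≤ C) : (L ^ k * x) * (1 + L) ^ N ≤ C := by
  refine le_trans ?_ h
  rw [pow_add]
  have : L ^ k ≤ (1 + L) ^ k := by gcongr; linarith
  calc L ^ k * x * (1 + L) ^ N ≤ (1 + L) ^ k * x * (1 + L) ^ N := by gcongr
    _ = _ := by ring

/-- The shifted integrand. -/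
noncomputable def HH (F : EuclideanSpace ℂ (Fin d) → ℂ) (v : EuclideanSpace ℝ (Fin d)) {k : ℕ}
    (m : Fin k → EuclideanSpace ℝ (Fin d)) (l : EuclideanSpace ℂ (Fin d)) : ℂ :=
  cexp (-(pair v l)) * (∏ j, -(pair (m j) l)) * F l

lemma norm_HH_le (F : EuclideanSpace ℂ (Fin d) → ℂ) (v : EuclideanSpace ℝ (Fin d)) {k : ℕ}
    (m : Fin k → EuclideanSpace ℝ (Fin d)) (l : EuclideanSpace ℂ (Fin d)) :
    ‖HH F v m l‖ ≤ Real.exp (-inner ℝ (reVec d l) v) * (∏ j, ‖m j‖) * (‖l‖ ^ k * ‖F l‖) := by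
  have h : ‖∏ j, -(pair (m j) l)‖ ≤ (∏ j, ‖m j‖) * ‖l‖ ^ k := by
    rw [norm_prod]
    calc ∏ j, ‖-(pair (m j) l)‖ ≤ ∏ j, (‖m j‖ * ‖l‖) := by
          refine Finset.prod_le_prod (fun _ _ => norm_nonneg _) fun j _ => ?_
          rw [norm_neg]; exact norm_pair_le _ _
      _ = _ := by simp [Finset.prod_mul_distrib]
  rw [HH, norm_mul, norm_mul, Complex.norm_exp, neg_re, pair_re]
  calc _ ≤ Real.exp (-inner ℝ (reVec d l) v) * ((∏ j, ‖m j‖) * ‖l‖ ^ k) * ‖F l‖ := by gcongr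
    _ = _ := by ring

lemma diff_HH {R : ℝ} {F : EuclideanSpace ℂ (Fin d) → ℂ}
    (hF : DifferentiableOn ℂ F {l | ‖reVec d l‖ < R}) (v : EuclideanSpace ℝ (Fin d)) {k : ℕ}
    (m : Fin k → EuclideanSpace ℝ (Fin d)) :
    DifferentiableOn ℂ (HH F v m) {l | ‖reVec d l‖ < R} := by
  unfold HH
  refine DifferentiableOn.mul (Differentiable.differentiableOn ?_) hF
  fun_prop

lemma bound_HH {F : EuclideanSpace ℂ (Fin d) → ℂ} {C r : ℝ} {k N : ℕ}
    (hC : ∀ l, ‖reVec d l‖ ≤ r → ‖F l‖ * (1 + ‖l‖) ^ (k + N) ≤ C)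
    (v : EuclideanSpace ℝ (Fin d)) (m : Fin k → EuclideanSpace ℝ (Fin d))
    (l : EuclideanSpace ℂ (Fin d)) (hl : ‖reVec d l‖ ≤ r) :
    ‖HH F v m l‖ * (1 + ‖l‖) ^ N ≤
      Real.exp (-inner ℝ (reVec d l) v) * (∏ j, ‖m j‖) * C := by
  have h1 := pow_absorb (norm_nonneg (F l)) (norm_nonneg l) (hC l hl)
  calc _ ≤ (Real.exp (-inner ℝ (reVec d l) v) * (∏ j, ‖m j‖) * (‖l‖ ^ k * ‖F l‖))
            * (1 + ‖l‖) ^ N := by gcongr; exact norm_HH_le F v m l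
    _ = Real.exp (-inner ℝ (reVec d l) v) * (∏ j, ‖m j‖) *
          ((‖l‖ ^ k * ‖F l‖) * (1 + ‖l‖) ^ N) := by ring
    _ ≤ _ := by
      have : 0 ≤ ∏ j, ‖m j‖ := Finset.prod_nonneg fun _ _ => norm_nonneg _
      gcongr

open scoped FourierTransform in
lemma main (d : ℕ) (R : ℝ) (hR : 0 < R) (f : EuclideanSpace ℝ (Fin d) → ℂ)
    (hcont : Continuous f) (hint : Integrable f)
    (F : EuclideanSpace ℂ (Fin d) → ℂ)
    (hF_holo : DifferentiableOn ℂ F {lam : EuclideanSpace ℂ (Fin d) | ‖reVec d lam‖ < R})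
    (hF_eq : ∀ ξ : EuclideanSpace ℝ (Fin d),
      F ((EuclideanSpace.equiv (Fin d) ℂ).symm fun i => Complex.I * (ξ i : ℂ)) =
        ∫ v : EuclideanSpace ℝ (Fin d),
          f v * Complex.exp (Complex.I * ∑ i, (ξ i : ℂ) * (v i : ℂ)))
    (hF_bound : ∀ r : ℝ, 0 < r → r < R → ∀ N : ℕ, ∃ C : ℝ,
      ∀ lam : EuclideanSpace ℂ (Fin d), ‖reVec d lam‖ ≤ r →
        ‖F lam‖ * (1 + ‖lam‖) ^ N ≤ C) :
    ContDiff ℝ (⊤ : ℕ∞) f ∧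
    ∀ r : ℝ, 0 < r → r < R → ∀ k : ℕ, ∃ C > 0,
      ∀ v : EuclideanSpace ℝ (Fin d),
        ‖iteratedFDeriv ℝ k f v‖ ≤ C * Real.exp (-r * ‖v‖) := by
  set φ : EuclideanSpace ℝ (Fin d) → ℂ := fun w => F (pt 0 0 w) with hφ
  have hinv : 𝓕⁻ f = φ := by
    ext w
    have h := hF_eq ((2 * Real.pi) • w)
    have e : ((EuclideanSpace.equiv (Fin d) ℂ).symm fun i =>
        Complex.I * ((((2 * Real.pi) • w) i : ℝ) : ℂ)) = pt 0 0 w := by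
      ext i; simp [pt]; ring
    rw [e] at h
    rw [hφ, Real.fourierInv_eq']
    simp only
    rw [h]
    refine integral_congr_ae (Eventually.of_forall fun v => ?_)
    simp only [smul_eq_mul]
    rw [mul_comm]
    congr 2
    simp only [PiLp.inner_apply, PiLp.smul_apply, smul_eq_mul, RCLike.inner_apply, conj_trivial]
    push_cast
    rw [Finset.mul_sum, Finset.mul_sum, Finset.sum_mul]
    refine Finset.sum_congr rfl fun i _ => ?_
    ring
  have hφc : Continuous φ := cont_slice hF_holo 0 0 (by simpa using hR)
  have hφi : ∀ n : ℕ, Integrable (fun w => ‖w‖ ^ n * ‖φ w‖) := by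
    intro n
    obtain ⟨C, hC⟩ := hF_bound (R / 2) (by positivity) (by linarith) (n + (d + 1))
    refine ((integrable_bound d).const_mul C).mono'
      (by fun_prop) (Eventually.of_forall fun w => ?_)
    have h1 : ‖φ w‖ * (1 + ‖w‖) ^ (n + (d + 1)) ≤ C := by
      refine le_trans ?_ (hC (pt 0 0 w) (by rw [norm_reVec_pt]; simp; positivity))
      have := one_add_norm_le 0 0 w (A := 0) (by simp)
      simp only [hφ]
      gcongr
      linarith
    have h2 := pow_absorb (norm_nonneg _) (norm_nonneg w) h1
    rw [Real.norm_of_nonneg (by positivity), ← div_eq_mul_inv, le_div_iff₀ (by positivity)]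
    exact h2
  have hφint : Integrable φ := by
    have := hφi 0
    simp only [pow_zero, one_mul] at this
    exact (integrable_norm_iff hφc.aestronglyMeasurable).1 this
  have hfi : Integrable (𝓕 f) := by
    have : 𝓕 f = fun w => φ (-w) := by
      ext w; rw [← hinv, Real.fourierInv_eq_fourier_neg, neg_neg]
    rw [this]
    exact hφint.comp_neg
  have hf : f = 𝓕 φ := by
    rw [← hinv]; exact (hcont.fourier_fourierInv_eq hint hfi).symm
  refine ⟨?_, ?_⟩
  · rw [hf]
    exact Real.contDiff_fourier (fun n _ => hφi n)
  intro r hr0 hrR k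
  have hform : ∀ v m, iteratedFDeriv ℝ k f v m = ∫ w, HH F v m (pt 0 0 w) := by
    intro v m
    rw [hf, Real.iteratedFDeriv_fourier (N := ⊤) (fun n _ => hφi n) hφc.aestronglyMeasurable
      (n := k) le_top,
      Real.fourier_continuousMultilinearMap_apply
        (VectorFourier.integrable_fourierPowSMulRight _ (hφi k) hφc.aestronglyMeasurable),
      Real.fourier_eq']
    refine integral_congr_ae (Eventually.of_forall fun w => ?_)
    simp only [VectorFourier.fourierPowSMulRight_apply, HH, smul_eq_mul, hφ, real_smul]
    have hp : ∀ u, pair u (pt 0 0 w) = (2 * Real.pi * I : ℂ) * ((inner ℝ w u : ℝ) : ℂ) := by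
      intro u
      simp [pt, pair_cV]
    simp only [hp]
    have hprod : ∏ j, -((2 * Real.pi * I : ℂ) * ((inner ℝ w (m j) : ℝ) : ℂ)) =
        (-(2 * Real.pi * I : ℂ)) ^ k * ((∏ j, inner ℝ w (m j) : ℝ) : ℂ) := by
      simp only [← neg_mul, Finset.prod_mul_distrib, Finset.prod_const, Finset.card_univ,
        Fintype.card_fin, ofReal_prod, mul_pow]
    rw [hprod]
    have hexp : (((-2 * Real.pi * inner ℝ w v : ℝ) : ℂ) * I) =
        -((2 * Real.pi * I : ℂ) * ((inner ℝ w v : ℝ) : ℂ)) := by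
      push_cast; ring
    rw [hexp]
    have hin : ∏ i, (innerSL ℝ w) (m i) = ∏ j, inner ℝ w (m j) := rfl
    have hin' := congrArg (fun x : ℝ => (x : ℂ)) hin
    rw [← hin']
    ring
  have hpt0 : ∀ η w, pt η 0 w = pt (0 : EuclideanSpace ℝ (Fin d)) 0 w := by
    intro η w; simp [pt]
  obtain ⟨C, hC⟩ := hF_bound r hr0 hrR (k + (d + 1))
  have hC0 : 0 ≤ C := le_trans (by positivity) (hC 0 (by
    have : reVec d 0 = 0 := by ext i; simp
    rw [this]; simpa using hr0.le))
  set K : ℝ := ∫ w : EuclideanSpace ℝ (Fin d), ((1 + ‖w‖) ^ (d + 1))⁻¹ with hK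
  have hK0 : 0 ≤ K := integral_nonneg fun w => by positivity
  refine ⟨C * (1 + r) ^ (d + 1) * K + 1, by positivity, fun v => ?_⟩
  refine ContinuousMultilinearMap.opNorm_le_bound (by positivity) fun m => ?_
  set η := (r / ‖v‖) • v with hη
  have hηn : ‖η‖ ≤ r := by
    rw [hη, norm_smul, norm_div, norm_norm, Real.norm_of_nonneg hr0.le]
    rcases eq_or_ne ‖v‖ 0 with h | h
    · simp [h, hr0.le]
    · rw [div_mul_cancel₀ _ h]
  have hηv : inner ℝ η v = r * ‖v‖ := by
    rw [hη, real_inner_smul_left, real_inner_self_eq_norm_sq]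
    rcases eq_or_ne ‖v‖ 0 with h | h
    · simp [h]
    · field_simp
  have hP : 0 ≤ ∏ j, ‖m j‖ := Finset.prod_nonneg fun _ _ => norm_nonneg _
  have hshift : ∫ w, HH F v m (pt 0 0 w) = ∫ w, HH F v m (pt η 1 w) := by
    rw [← shift (diff_HH hF_holo v m) ?_ η (hηn.trans_lt hrR)]
    · simp only [hpt0 η]
    · intro s hs0 hsR
      obtain ⟨D, hD⟩ := hF_bound s hs0 hsR (k + (d + 1))
      have hD0 : 0 ≤ D := le_trans (by positivity) (hD 0 (by
        have : reVec d 0 = 0 := by ext i; simp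
        rw [this]; simpa using hs0.le))
      refine ⟨Real.exp (s * ‖v‖) * (∏ j, ‖m j‖) * D, fun l hl => ?_⟩
      refine (bound_HH hD v m l hl).trans ?_
      gcongr
      have h1 := abs_le.1 (abs_real_inner_le_norm (reVec d l) v)
      have h2 : ‖reVec d l‖ * ‖v‖ ≤ s * ‖v‖ := by gcongr
      linarith [h1.1]
  rw [hform, hshift]
  have hpw : ∀ w, ‖HH F v m (pt η 1 w)‖ ≤
      Real.exp (-r * ‖v‖) * (∏ j, ‖m j‖) * C * (1 + r) ^ (d + 1) * ((1 + ‖w‖) ^ (d + 1))⁻¹ := by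
    intro w
    refine key_bound η 1 w (by simpa using hηn) (norm_nonneg _) ?_
    have h1 : reVec d (pt η 1 w) = η := by rw [reVec_pt]; simp
    have h2 := bound_HH hC v m (pt η 1 w) (by rw [h1]; exact hηn)
    rw [h1, hηv, ← neg_mul] at h2
    exact h2
  have hfin := norm_integral_le_of_norm_le ((integrable_bound d).const_mul
    (Real.exp (-r * ‖v‖) * (∏ j, ‖m j‖) * C * (1 + r) ^ (d + 1)))
    (Eventually.of_forall hpw)
  rw [integral_const_mul, ← hK] at hfin
  refine hfin.trans ?_
  have : 0 ≤ Real.exp (-r * ‖v‖) * ∏ j, ‖m j‖ := by positivity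
  nlinarith

end ExpDecay

/-- If a continuous integrable `f : ℝ^d → ℂ` has a Fourier transform extending to a
holomorphic function on the tube `{λ : ‖Re λ‖ < R}` which decays faster than any inverse
polynomial uniformly on `{λ : ‖Re λ‖ ≤ r}` for every `r < R`, then `f` is smooth and all
its iterated derivatives decay like `exp (-r‖v‖)` for every `r < R`. -/
theorem exp_decay_of_fourierLaplace_decay
    (d : ℕ) (R : ℝ) (hR : 0 < R) (f : EuclideanSpace ℝ (Fin d) → ℂ)
    (hcont : Continuous f) (hint : Integrable f)
    (F : EuclideanSpace ℂ (Fin d) → ℂ)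
    (hF_holo : DifferentiableOn ℂ F {lam : EuclideanSpace ℂ (Fin d) | ‖reVec d lam‖ < R})
    (hF_eq : ∀ ξ : EuclideanSpace ℝ (Fin d),
      F ((EuclideanSpace.equiv (Fin d) ℂ).symm fun i => Complex.I * (ξ i : ℂ)) =
        ∫ v : EuclideanSpace ℝ (Fin d),
          f v * Complex.exp (Complex.I * ∑ i, (ξ i : ℂ) * (v i : ℂ)))
    (hF_bound : ∀ r : ℝ, 0 < r → r < R → ∀ N : ℕ, ∃ C : ℝ,
      ∀ lam : EuclideanSpace ℂ (Fin d), ‖reVec d lam‖ ≤ r →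
        ‖F lam‖ * (1 + ‖lam‖) ^ N ≤ C) :
    ContDiff ℝ (⊤ : ℕ∞) f ∧
    ∀ r : ℝ, 0 < r → r < R → ∀ k : ℕ, ∃ C > 0,
      ∀ v : EuclideanSpace ℝ (Fin d),
        ‖iteratedFDeriv ℝ k f v‖ ≤ C * Real.exp (-r * ‖v‖) := by
  exact ExpDecay.main d R hR f hcont hint F hF_holo hF_eq hF_bound
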